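/- Let μ and λ be Borel measures on Sⁿ⁻¹ with densities f and g (positive and continuous) with respect to spherical Lebesgue measure. If f and g are even functions and ∫_{Sⁿ⁻¹} f dx = ∫_{Sⁿ⁻¹} g du, then μ and λ are Aleksandrov related: λ(Sⁿ⁻¹) = μ(Sⁿ⁻¹) > λ(ω*) + μ(ω) for every compact, spherically convex set ω ⊊ Sⁿ⁻¹ that is not the whole sphere. -/

import Mathlib

open scoped RealInnerProductSpace MeasureTheory ENNReal
open MeasureTheory Metric Module Topology Submodule

section SphereMeasure

variable {E : Type*} [NormedAddCommGroup E] [InnerProductSpace ℝ E]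

theorem innerSL_neg_self_ne_one {x : E} (hx : ‖x‖ = 1) : innerSL ℝ (-x) x ≠ (1 : ℝ) := by
  simp [hx]
  norm_num

theorem isOpen_innerSL_ne_one (v : E) : IsOpen {x : E | innerSL ℝ v x ≠ (1 : ℝ)} :=
  isOpen_ne_fun (innerSL ℝ v).continuous continuous_const

theorem exists_mem_sphere_notMem_polar_union_neg {ω : Set E} (hωS : ω ⊆ sphere 0 1)
    {u w : E} (hu : u ∈ ω) (hw : w ∈ ω) (hne : u ≠ w) :
    ∃ x ∈ sphere (0 : E) 1, x ∉ {v | v ∈ sphere (0 : E) 1 ∧ ∀ u ∈ ω, ⟪u, v⟫ ≤ 0} ∪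
      -{v | v ∈ sphere (0 : E) 1 ∧ ∀ u ∈ ω, ⟪u, v⟫ ≤ 0} := by
  have hu1 : ‖u‖ = 1 := by simpa using hωS hu
  have hw1 : ‖w‖ = 1 := by simpa using hωS hw
  have hlt : ⟪u, w⟫ < 1 := (inner_lt_one_iff_real_of_norm_eq_one hu1 hw1).2 hne
  have hpos : 0 < ‖u - w‖⁻¹ := inv_pos.2 (norm_pos_iff.2 (sub_ne_zero.2 hne))
  refine ⟨‖u - w‖⁻¹ • (u - w), ?_, ?_⟩
  · simp [norm_smul, sub_ne_zero.2 hne]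
  · rintro (⟨-, h⟩ | ⟨-, h⟩)
    · have := h u hu
      rw [inner_smul_right, inner_sub_right, real_inner_self_eq_norm_sq, hu1] at this
      nlinarith
    · have := h w hw
      rw [inner_neg_right, inner_smul_right, inner_sub_right, real_inner_self_eq_norm_sq, hw1,
        real_inner_comm] at this
      nlinarith

variable [FiniteDimensional ℝ E]

theorem cast_finrank_orthogonal_singleton {v : E} (hv : v ≠ 0) :
    (finrank ℝ (ℝ ∙ v)ᗮ : ℝ) = (finrank ℝ E : ℝ) - 1 := by
  have h := (ℝ ∙ v).finrank_add_finrank_orthogonal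
  rw [finrank_span_singleton hv] at h
  rw [← h]
  push_cast
  ring

variable [MeasurableSpace E] [BorelSpace E]

theorem hausdorffMeasure_sphere_inter_pos {x : E} (hx : ‖x‖ = 1) {V : Set E} (hV : V ∈ 𝓝 x) :
    0 < μH[(finrank ℝ E : ℝ) - 1] (V ∩ sphere 0 1) := by
  have hv : ‖-x‖ = 1 := by rwa [norm_neg]
  have hv0 : -x ≠ 0 := norm_ne_zero_iff.1 (by simp [hx])
  have hsmooth : ContDiffAt ℝ 1 (stereoToFun (-x)) x :=
    contDiffOn_stereoToFun.contDiffAt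
      ((isOpen_innerSL_ne_one _).mem_nhds (innerSL_neg_self_ne_one hx))
  obtain ⟨K, t, ht, hK⟩ := hsmooth.exists_lipschitzOnWith
  have hinv : stereoInvFunAux (-x) ((0 : (ℝ ∙ (-x))ᗮ) : E) = x := by
    simp [stereoInvFunAux_apply]
  have hcont : Continuous fun w : (ℝ ∙ (-x))ᗮ => stereoInvFunAux (-x) (w : E) :=
    (contDiff_stereoInvFunAux (m := 0)).continuous.comp continuous_subtype_val
  have hW : (fun w : (ℝ ∙ (-x))ᗮ => stereoInvFunAux (-x) (w : E)) ⁻¹' (V ∩ t) ∈ 𝓝 0 :=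
    hcont.continuousAt.preimage_mem_nhds (by rw [hinv]; exact Filter.inter_mem hV ht)
  have hsub : (fun w : (ℝ ∙ (-x))ᗮ => stereoInvFunAux (-x) (w : E)) ⁻¹' (V ∩ t) ⊆
      stereoToFun (-x) '' (V ∩ t ∩ sphere 0 1) := fun w hw =>
    ⟨_, ⟨hw, stereoInvFunAux_mem hv w.2⟩, stereo_right_inv hv w⟩
  have hpos : 0 < μH[(finrank ℝ (ℝ ∙ (-x))ᗮ : ℝ)]
      ((fun w : (ℝ ∙ (-x))ᗮ => stereoInvFunAux (-x) (w : E)) ⁻¹' (V ∩ t)) :=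
    Measure.measure_pos_of_mem_nhds _ hW
  have hle := (hK.mono (s := V ∩ t ∩ sphere 0 1) fun y hy => hy.1.2).hausdorffMeasure_image_le
    (d := finrank ℝ (ℝ ∙ (-x))ᗮ) (Nat.cast_nonneg _)
  have hlt := hpos.trans_le ((measure_mono hsub).trans hle)
  rw [cast_finrank_orthogonal_singleton hv0] at hlt
  exact (pos_of_mul_pos_right hlt zero_le).trans_le
    (measure_mono (Set.inter_subset_inter_left _ Set.inter_subset_left))

theorem hausdorffMeasure_sphere_lt_top :
    μH[(finrank ℝ E : ℝ) - 1] (sphere (0 : E) 1) < ∞ := by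
  refine (isCompact_sphere 0 1).measure_lt_top_of_nhdsWithin fun x hxS => ?_
  have hx : ‖x‖ = 1 := by simpa using hxS
  have hv : ‖-x‖ = 1 := by rwa [norm_neg]
  have hv0 : -x ≠ 0 := norm_ne_zero_iff.1 (by simp [hx])
  have hsmooth : ContDiffAt ℝ 1 (fun w : (ℝ ∙ (-x))ᗮ => stereoInvFunAux (-x) (w : E))
      (stereoToFun (-x) x) :=
    (contDiff_stereoInvFunAux.comp (ℝ ∙ (-x))ᗮ.subtypeL.contDiff).contDiffAt
  obtain ⟨K, t, ht, hK⟩ := hsmooth.exists_lipschitzOnWith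
  obtain ⟨s, hs, hsfin⟩ :=
    (μH[(finrank ℝ (ℝ ∙ (-x))ᗮ : ℝ)]).finiteAt_nhds (stereoToFun (-x) x)
  have hopen := (isOpen_innerSL_ne_one (-x)).mem_nhds (innerSL_neg_self_ne_one hx)
  have hpre : stereoToFun (-x) ⁻¹' (t ∩ s) ∩ {y | innerSL ℝ (-x) y ≠ (1 : ℝ)} ∈ 𝓝 x :=
    Filter.inter_mem ((continuousOn_stereoToFun.continuousAt hopen).preimage_mem_nhds
      (Filter.inter_mem ht hs)) hopen
  refine ⟨_, inter_mem_nhdsWithin (sphere 0 1) hpre, ?_⟩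
  have hsub : sphere 0 1 ∩ (stereoToFun (-x) ⁻¹' (t ∩ s) ∩ {y | innerSL ℝ (-x) y ≠ (1 : ℝ)}) ⊆
      (fun w : (ℝ ∙ (-x))ᗮ => stereoInvFunAux (-x) (w : E)) '' (t ∩ s) := by
    rintro y ⟨hyS, hy, hy1⟩
    refine ⟨stereoToFun (-x) y, hy, ?_⟩
    have hne : y ≠ -x := by
      rintro rfl
      exact hy1 (by simp [hx])
    exact congrArg Subtype.val (stereo_left_inv hv (x := ⟨y, hyS⟩) hne)
  have hle := (hK.mono (s := t ∩ s) Set.inter_subset_left).hausdorffMeasure_image_le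
    (d := finrank ℝ (ℝ ∙ (-x))ᗮ) (Nat.cast_nonneg _)
  rw [← cast_finrank_orthogonal_singleton hv0]
  refine ((measure_mono hsub).trans hle).trans_lt (ENNReal.mul_lt_top ?_ ?_)
  · exact ENNReal.rpow_lt_top_of_nonneg (Nat.cast_nonneg _) ENNReal.coe_ne_top
  · exact (measure_mono Set.inter_subset_right).trans_lt hsfin

theorem hausdorffMeasure_sphere_inter_orthogonal {v : E} (hv : v ≠ 0) :
    μH[(finrank ℝ E : ℝ) - 1] (sphere (0 : E) 1 ∩ (ℝ ∙ v)ᗮ) = 0 := by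
  have himage : sphere (0 : E) 1 ∩ (ℝ ∙ v)ᗮ =
      ((↑) : (ℝ ∙ v)ᗮ → E) '' sphere (0 : (ℝ ∙ v)ᗮ) 1 := by
    ext y
    simp
  rw [himage, ← cast_finrank_orthogonal_singleton hv,
    isometry_subtype_coe.hausdorffMeasure_image (Or.inl (Nat.cast_nonneg _))]
  exact Measure.addHaar_sphere_of_ne_zero _ _ one_ne_zero

end SphereMeasure

theorem two_mul_measure_of_neg_invariant {G : Type*} [MeasurableSpace G] [InvolutiveNeg G]
    [MeasurableNeg G] (m : Measure G) [m.IsNegInvariant] {A : Set G} (hA : MeasurableSet A)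
    (hnull : m (A ∩ -A) = 0) : m A + m A = m (A ∪ -A) := by
  have h := measure_union_add_inter (μ := m) A hA.neg
  rw [hnull, add_zero, Measure.measure_neg] at h
  exact h.symm

theorem isNegInvariant_withDensity {G : Type*} [MeasurableSpace G] [InvolutiveNeg G]
    [MeasurableNeg G] (m : Measure G) [m.IsNegInvariant] {φ : G → ℝ≥0∞} (hφ : Measurable φ)
    (heven : ∀ x, φ (-x) = φ x) : (m.withDensity φ).IsNegInvariant := by
  refine ⟨Measure.ext fun s hs => ?_⟩
  rw [Measure.neg_apply, withDensity_apply _ hs.neg, withDensity_apply _ hs]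
  have h := (Measure.measurePreserving_neg m).setLIntegral_comp_preimage hs hφ
  simpa only [heven, Set.neg_preimage] using h

theorem ENNReal.add_lt_of_add_self {a b T : ℝ≥0∞} (hT : T ≠ ∞) (ha : a + a < T)
    (hb : b + b ≤ T) : a + b < T := by
  lift T to NNReal using hT
  have ha' : a ≠ ∞ := fun h => by simp [h] at ha
  have hb' : b ≠ ∞ := fun h => by simp [h] at hb
  lift a to NNReal using ha'
  lift b to NNReal using hb'
  norm_cast at *
  simp only [← NNReal.coe_lt_coe, ← NNReal.coe_le_coe, NNReal.coe_add] at *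
  linarith

section WeightedSphere

variable {E : Type*} [NormedAddCommGroup E] [InnerProductSpace ℝ E] [FiniteDimensional ℝ E]
  [MeasurableSpace E] [BorelSpace E]

instance isNegInvariant_hausdorffMeasure_restrict_sphere (d r : ℝ) :
    ((μH[d] : Measure E).restrict (sphere 0 r)).IsNegInvariant := by
  refine ⟨?_⟩
  have h := ((IsometryEquiv.neg E).measurePreserving_hausdorffMeasure d).restrict_preimage
    (isClosed_sphere (x := (0 : E)) (ε := r)).measurableSet
  have hS : (IsometryEquiv.neg E) ⁻¹' sphere 0 r = sphere 0 r := by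
    ext y
    simp
  rw [hS] at h
  exact h.map_eq

theorem withDensity_sphere_lt_of_isClosed {φ : E → ℝ≥0∞} (hφ : Measurable φ)
    (hpos : ∀ x ∈ sphere (0 : E) 1, φ x ≠ 0)
    (hfin : ((μH[(finrank ℝ E : ℝ) - 1] : Measure E).restrict (sphere 0 1)).withDensity φ
      (sphere 0 1) ≠ ∞)
    {A : Set E} (hA : IsClosed A) (hAS : A ⊆ sphere 0 1) {x : E} (hxS : x ∈ sphere (0 : E) 1)
    (hxA : x ∉ A) :
    ((μH[(finrank ℝ E : ℝ) - 1] : Measure E).restrict (sphere 0 1)).withDensity φ A <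
      ((μH[(finrank ℝ E : ℝ) - 1] : Measure E).restrict (sphere 0 1)).withDensity φ
        (sphere 0 1) := by
  have hS : MeasurableSet (sphere (0 : E) 1) := isClosed_sphere.measurableSet
  rw [← tsub_pos_iff_lt, ← measure_sdiff hAS hA.measurableSet.nullMeasurableSet
    (ne_top_of_le_ne_top hfin (measure_mono hAS)), pos_iff_ne_zero, Ne,
    withDensity_apply_eq_zero hφ, Measure.restrict_apply' hS]
  have hlt := hausdorffMeasure_sphere_inter_pos (by simpa using hxS) (hA.isOpen_compl.mem_nhds hxA)
  refine fun h => hlt.ne' (measure_mono_null ?_ h)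
  exact fun y hy => ⟨⟨hpos y hy.2, hy.2, hy.1⟩, hy.2⟩

theorem withDensity_sphere_inter_neg_eq_zero {φ : E → ℝ≥0∞} {A : Set E}
    (hA : A ⊆ sphere 0 1) {v : E} (hv : v ≠ 0)
    (hhemi : (∀ u ∈ A, 0 ≤ ⟪u, v⟫) ∨ ∀ u ∈ A, ⟪u, v⟫ ≤ 0) :
    ((μH[(finrank ℝ E : ℝ) - 1] : Measure E).restrict (sphere 0 1)).withDensity φ
      (A ∩ -A) = 0 := by
  have hsub : A ∩ -A ⊆ sphere (0 : E) 1 ∩ (ℝ ∙ v)ᗮ := by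
    rintro y ⟨hy, hy'⟩
    refine ⟨hA hy, mem_orthogonal_singleton_iff_inner_left.2 ?_⟩
    rcases hhemi with h | h <;>
    · have h1 := h _ hy
      have h2 := h _ hy'
      rw [inner_neg_left] at h2
      linarith
  exact withDensity_absolutelyContinuous _ _ (Measure.absolutelyContinuous_of_le
    Measure.restrict_le_self
    (measure_mono_null hsub (hausdorffMeasure_sphere_inter_orthogonal hv)))

end WeightedSphere

/-- If `μ` and `λ` are the measures on `Sⁿ⁻¹` with positive continuous even
densities `f`, `g` (w.r.t. spherical Lebesgue measure) and equal total mass, then they are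
Aleksandrov related: `λ(Sⁿ⁻¹) = μ(Sⁿ⁻¹) > λ(ω*) + μ(ω)` for every nonempty compact
spherically convex `ω ⊊ Sⁿ⁻¹`. -/
theorem even_densities_aleksandrov_related {n : ℕ} (hn : 2 ≤ n)
    (f g : EuclideanSpace ℝ (Fin n) → ℝ)
    (hf : Continuous f) (hg : Continuous g)
    (hfpos : ∀ x ∈ Metric.sphere (0 : EuclideanSpace ℝ (Fin n)) 1, 0 < f x)
    (hgpos : ∀ u ∈ Metric.sphere (0 : EuclideanSpace ℝ (Fin n)) 1, 0 < g u)
    (hfeven : ∀ x, f (-x) = f x) (hgeven : ∀ u, g (-u) = g u)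
    (htot : ∫ x in Metric.sphere (0 : EuclideanSpace ℝ (Fin n)) 1, f x ∂μH[(n : ℝ) - 1]
      = ∫ u in Metric.sphere (0 : EuclideanSpace ℝ (Fin n)) 1, g u ∂μH[(n : ℝ) - 1])
    (ω : Set (EuclideanSpace ℝ (Fin n)))
    (hωS : ω ⊆ Metric.sphere (0 : EuclideanSpace ℝ (Fin n)) 1)
    (hωne : ω.Nonempty) (hωcomp : IsCompact ω)
    (hωproper : ω ≠ Metric.sphere (0 : EuclideanSpace ℝ (Fin n)) 1)
    -- spherical convexity: the cone over `ω` is convex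
    (hωconv : Convex ℝ {y : EuclideanSpace ℝ (Fin n) | ∃ c : ℝ, 0 ≤ c ∧ ∃ v ∈ ω, y = c • v})
    -- `ω` is contained in a closed hemisphere
    (hωhemi : ∃ v ∈ Metric.sphere (0 : EuclideanSpace ℝ (Fin n)) 1, ∀ u ∈ ω, 0 ≤ ⟪u, v⟫) :
    ((μH[(n : ℝ) - 1] : Measure (EuclideanSpace ℝ (Fin n))).restrict
        (Metric.sphere 0 1)).withDensity (fun u => ENNReal.ofReal (g u))
      (Metric.sphere (0 : EuclideanSpace ℝ (Fin n)) 1)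
    = ((μH[(n : ℝ) - 1] : Measure (EuclideanSpace ℝ (Fin n))).restrict
        (Metric.sphere 0 1)).withDensity (fun x => ENNReal.ofReal (f x))
      (Metric.sphere (0 : EuclideanSpace ℝ (Fin n)) 1) ∧
    ((μH[(n : ℝ) - 1] : Measure (EuclideanSpace ℝ (Fin n))).restrict
        (Metric.sphere 0 1)).withDensity (fun u => ENNReal.ofReal (g u))
      {v : EuclideanSpace ℝ (Fin n) |
        v ∈ Metric.sphere (0 : EuclideanSpace ℝ (Fin n)) 1 ∧ ∀ u ∈ ω, ⟪u, v⟫ ≤ 0}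
    + ((μH[(n : ℝ) - 1] : Measure (EuclideanSpace ℝ (Fin n))).restrict
        (Metric.sphere 0 1)).withDensity (fun x => ENNReal.ofReal (f x)) ω
    < ((μH[(n : ℝ) - 1] : Measure (EuclideanSpace ℝ (Fin n))).restrict
        (Metric.sphere 0 1)).withDensity (fun u => ENNReal.ofReal (g u))
      (Metric.sphere (0 : EuclideanSpace ℝ (Fin n)) 1) := by
  set S := sphere (0 : EuclideanSpace ℝ (Fin n)) 1 with hSdef
  have hdim : (n : ℝ) - 1 = (finrank ℝ (EuclideanSpace ℝ (Fin n)) : ℝ) - 1 := by simp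
  rw [hdim] at htot ⊢
  set ν := (μH[(finrank ℝ (EuclideanSpace ℝ (Fin n)) : ℝ) - 1] :
    Measure (EuclideanSpace ℝ (Fin n))).restrict S with hν
  set P := {v : EuclideanSpace ℝ (Fin n) | v ∈ S ∧ ∀ u ∈ ω, ⟪u, v⟫ ≤ 0} with hP
  have hSfin : μH[(finrank ℝ (EuclideanSpace ℝ (Fin n)) : ℝ) - 1] S < ∞ :=
    hausdorffMeasure_sphere_lt_top
  have hSmeas : MeasurableSet S := isClosed_sphere.measurableSet
  have htotal : ∀ h : EuclideanSpace ℝ (Fin n) → ℝ, Continuous h → (∀ x ∈ S, 0 < h x) →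
      ν.withDensity (fun x => ENNReal.ofReal (h x)) S = ENNReal.ofReal (∫ x, h x ∂ν) := by
    intro h hc hpos
    rw [withDensity_apply _ hSmeas, hν, Measure.restrict_restrict hSmeas, Set.inter_self,
      ofReal_integral_eq_lintegral_ofReal]
    · exact hc.continuousOn.integrableOn_of_subset_isCompact (isCompact_sphere 0 1) hSmeas
        subset_rfl hSfin.ne
    · exact (ae_restrict_mem hSmeas).mono fun x hx => (hpos x hx).le
  have heq : ν.withDensity (fun u => ENNReal.ofReal (g u)) S =
      ν.withDensity (fun x => ENNReal.ofReal (f x)) S := by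
    rw [htotal g hg hgpos, htotal f hf hfpos, htot]
  refine ⟨heq, ?_⟩
  have hgm : Measurable fun u => ENNReal.ofReal (g u) := hg.measurable.ennreal_ofReal
  have hfm : Measurable fun x => ENNReal.ofReal (f x) := hf.measurable.ennreal_ofReal
  have hgne : ∀ x ∈ S, ENNReal.ofReal (g x) ≠ 0 := fun x hx => by simpa using hgpos x hx
  have hgfin : ν.withDensity (fun u => ENNReal.ofReal (g u)) S ≠ ∞ := by
    rw [htotal g hg hgpos]
    exact ENNReal.ofReal_ne_top
  have hPS : P ⊆ S := fun v hv => hv.1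
  have hnegS : ∀ {A : Set (EuclideanSpace ℝ (Fin n))}, A ⊆ S → A ∪ -A ⊆ S := fun hA =>
    Set.union_subset hA fun y hy => by simpa [hSdef] using hA hy
  have hPclosed : IsClosed P := by
    have : P = S ∩ ⋂ u ∈ ω, {v | ⟪u, v⟫ ≤ 0} := by
      ext
      simp [hP]
    rw [this]
    exact isClosed_sphere.inter (isClosed_biInter fun u _ =>
      isClosed_le (continuous_const.inner continuous_id) continuous_const)
  obtain ⟨u, hu⟩ := hωne
  obtain ⟨v, hvS, hv⟩ := hωhemi
  have hSne : ∀ {x}, x ∈ S → x ≠ 0 := fun hx => ne_zero_of_mem_unit_sphere ⟨_, hx⟩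
  have := isNegInvariant_withDensity ν hgm fun x => by rw [hgeven]
  have := isNegInvariant_withDensity ν hfm fun x => by rw [hfeven]
  have hPdouble := two_mul_measure_of_neg_invariant
    (ν.withDensity fun u => ENNReal.ofReal (g u)) hPclosed.measurableSet
    (withDensity_sphere_inter_neg_eq_zero hPS (hSne (hωS hu))
      (Or.inr fun y hy => (real_inner_comm _ _).trans_le (hy.2 u hu)))
  have hωdouble := two_mul_measure_of_neg_invariant
    (ν.withDensity fun x => ENNReal.ofReal (f x)) hωcomp.isClosed.measurableSet
    (withDensity_sphere_inter_neg_eq_zero hωS (hSne hvS) (Or.inl hv))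
  have hPle := hPdouble.trans_le (measure_mono (hnegS hPS))
  have hωle := (hωdouble.trans_le (measure_mono (hnegS hωS))).trans_eq heq.symm
  by_cases hsing : ∃ w ∈ ω, u ≠ w
  · obtain ⟨w, hw, hne⟩ := hsing
    obtain ⟨x, hxS, hx⟩ := exists_mem_sphere_notMem_polar_union_neg hωS hu hw hne
    exact ENNReal.add_lt_of_add_self hgfin (hPdouble.trans_lt
      (withDensity_sphere_lt_of_isClosed hgm hgne hgfin
        (hPclosed.union hPclosed.neg) (hnegS hPS) hxS hx)) hωle
  · push Not at hsing
    have hd : (0 : ℝ) < (finrank ℝ (EuclideanSpace ℝ (Fin n)) : ℝ) - 1 := by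
      rw [← hdim, sub_pos]
      exact_mod_cast hn
    have := Measure.nullSingletonClass_hausdorff (EuclideanSpace ℝ (Fin n)) hd
    have hω0 : ν.withDensity (fun x => ENNReal.ofReal (f x)) ω = 0 :=
      measure_mono_null (t := {u}) (fun w hw => (hsing w hw).symm)
        (withDensity_absolutelyContinuous _ _ (measure_singleton u))
    have hTpos := zero_le.trans_lt (withDensity_sphere_lt_of_isClosed hgm hgne hgfin
      isClosed_empty (Set.empty_subset S) hvS (Set.notMem_empty v))
    rw [add_comm]
    refine ENNReal.add_lt_of_add_self hgfin ?_ hPle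
    rwa [hω0, add_zero]
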